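/- arXiv:2002.03658 — 3 statements merged into one kernel-verified Lean document; each statement's English description precedes it below -/
import Mathlib

section
/- Let Ω = ℕ → ℝ with the product σ-algebra, and for each n ≥ 1 let Xₙ : Ω → ℝⁿ be the projection onto the first n coordinates. Let Θ = ℝ^d, and let (P_θ)_{θ ∈ Θ} be a family of probability measures on Ω such that θ ↦ P_θ(A) is measurable for every measurable set A. Suppose pₙ : ℝⁿ × Θ → [0, ∞) is jointly measurable and, for every θ and every n ≥ 1, the pushforward of P_θ under Xₙ has density pₙ(·, θ) with respect to Lebesgue measure on ℝⁿ. Let π : Θ → [0, ∞) be measurable with ∫_Θ π(θ) dθ = 1, and define the mixture density qₙ(x) = ∫_Θ pₙ(x, θ) π(θ) dθ. Then for every θ₀ ∈ Θ and every ε ∈ (0, 1], P_{θ₀}({ω : for every n ≥ 1, pₙ(Xₙ(ω), θ₀) ≥ ε · qₙ(Xₙ(ω))}) ≥ 1 − ε. -/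
open MeasureTheory

/-- If `P` is dominated by `c • Q` on the events `X n ∈ C` with `C ⊆ B n`, `X n` the first `n` coordinates, then the
probability that some prefix `X n` falls in `B n` is at most `c * Q univ`. -/
theorem measure_iUnion_prefix_le {P Q : Measure (ℕ → ℝ)} {c : ENNReal}
    {B : (n : ℕ) → Set (Fin n → ℝ)} (hB : ∀ n, MeasurableSet (B n))
    (hle : ∀ n, ∀ C ⊆ B n, MeasurableSet C →
      P ((fun ω (i : Fin n) => ω i) ⁻¹' C) ≤ c * Q ((fun ω (i : Fin n) => ω i) ⁻¹' C)) :
    P (⋃ n, (fun ω (i : Fin n) => ω i) ⁻¹' B n) ≤ c * Q Set.univ := by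
  set A : ℕ → Set (ℕ → ℝ) := fun n => (fun ω (i : Fin n) => ω i) ⁻¹' B n with hA
  have hAm : ∀ n, MeasurableSet (A n) := fun n =>
    (measurable_pi_lambda _ fun i => measurable_pi_apply _) (hB n)
  have hDm : ∀ n, MeasurableSet (disjointed A n) := fun n => MeasurableSet.disjointed hAm n
  have hD : ∀ n, P (disjointed A n) ≤ c * Q (disjointed A n) := by
    intro n
    have key : disjointed A n = (fun ω (i : Fin n) => ω i) ⁻¹'
        (B n \ ⋃ k : Fin n, (fun (x : Fin n → ℝ) (i : Fin k) => x (i.castLE k.2.le)) ⁻¹' B k) := by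
      ext ω
      rw [disjointed_eq_inter_compl]
      simp [hA, Fin.forall_iff]
    rw [key]
    refine hle n _ Set.sdiff_subset ((hB n).diff (MeasurableSet.iUnion fun k => ?_))
    exact (measurable_pi_lambda _ fun i => measurable_pi_apply _) (hB k)
  calc P (⋃ n, A n) = ∑' n, P (disjointed A n) := by
        rw [← iUnion_disjointed, measure_iUnion (disjoint_disjointed A) hDm]
    _ ≤ ∑' n, c * Q (disjointed A n) := ENNReal.tsum_le_tsum hD
    _ = c * Q (⋃ n, disjointed A n) := by
        rw [ENNReal.tsum_mul_left, measure_iUnion (disjoint_disjointed A) hDm]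
    _ ≤ c * Q Set.univ := by gcongr; exact Set.subset_univ _

/-- **Simultaneous coverage of Robbins' confidence sequences.** Let `Ω = ℕ → ℝ` with the product
σ-algebra, `X n` the projection onto the first `n` coordinates, and `(P θ)` a measurable family of
probability measures on `Ω` such that for each `θ` and each `n ≥ 1` the law of `X n` under `P θ`
has density `p n (·) θ` with respect to Lebesgue measure on `ℝⁿ`. Let `π` be a probability density
on `Θ = ℝ^d` and `q n x = ∫ p n x θ π(θ) dθ` the mixture density. Then for every `θ₀` and every
`ε ∈ (0, 1]`, with `P θ₀`-probability at least `1 - ε` we have `p n (X n ω) θ₀ ≥ ε * q n (X n ω)`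
simultaneously for all `n ≥ 1`. -/
theorem robbins_confidence_sequence_coverage
    {d : ℕ}
    (P : (Fin d → ℝ) → Measure (ℕ → ℝ))
    (hPprob : ∀ θ, IsProbabilityMeasure (P θ))
    (hPmeas : ∀ A : Set (ℕ → ℝ), MeasurableSet A → Measurable fun θ => P θ A)
    (p : (n : ℕ) → (Fin n → ℝ) → (Fin d → ℝ) → ENNReal)
    (hpmeas : ∀ n : ℕ, Measurable fun x : (Fin n → ℝ) × (Fin d → ℝ) => p n x.1 x.2)
    (hdensity : ∀ θ, ∀ n : ℕ, 1 ≤ n →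
      (P θ).map (fun ω (i : Fin n) => ω i)
        = (volume : Measure (Fin n → ℝ)).withDensity (fun x => p n x θ))
    (π : (Fin d → ℝ) → ENNReal)
    (hπmeas : Measurable π)
    (hπint : ∫⁻ θ, π θ = 1)
    (q : (n : ℕ) → (Fin n → ℝ) → ENNReal)
    (hq : ∀ n : ℕ, ∀ x : Fin n → ℝ, q n x = ∫⁻ θ, p n x θ * π θ)
    (θ₀ : Fin d → ℝ) (ε : ℝ) (hε : 0 < ε) (hε1 : ε ≤ 1) :
    1 - ENNReal.ofReal ε ≤
      P θ₀ {ω | ∀ n : ℕ, 1 ≤ n →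
        ENNReal.ofReal ε * q n (fun i : Fin n => ω i) ≤ p n (fun i : Fin n => ω i) θ₀} := by
  have hP : Measurable P := Measure.measurable_of_measurable_coe _ hPmeas
  have hX : ∀ n : ℕ, Measurable fun (ω : ℕ → ℝ) (i : Fin n) => ω i := fun n =>
    measurable_pi_lambda _ fun i => measurable_pi_apply _
  have hqmeas : ∀ n, Measurable (q n) := fun n => by
    rw [funext (hq n)]
    exact ((hpmeas n).mul (hπmeas.comp measurable_snd)).lintegral_prod_right'
  have hp₀ : ∀ θ n, Measurable fun x => p n x θ := fun θ n =>
    (hpmeas n).comp measurable_prodMk_right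
  have hlaw : ∀ θ, ∀ n : ℕ, 1 ≤ n → ∀ C : Set (Fin n → ℝ), MeasurableSet C →
      P θ ((fun ω (i : Fin n) => ω i) ⁻¹' C) = ∫⁻ x in C, p n x θ := fun θ n hn C hC => by
    rw [← Measure.map_apply (hX n) hC, hdensity θ n hn, withDensity_apply _ hC]
  set Q : Measure (ℕ → ℝ) := (volume.withDensity π).bind P with hQ
  have hQapply : ∀ A, MeasurableSet A → Q A = ∫⁻ θ, π θ * P θ A := fun A hA => by
    rw [hQ, Measure.bind_apply hA hP.aemeasurable,
      lintegral_withDensity_eq_lintegral_mul _ hπmeas (hPmeas A hA)]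
    rfl
  have hQuniv : Q Set.univ = 1 := by
    rw [hQapply _ MeasurableSet.univ]
    simpa using hπint
  have hQlaw : ∀ n : ℕ, 1 ≤ n → ∀ C : Set (Fin n → ℝ), MeasurableSet C →
      Q ((fun ω (i : Fin n) => ω i) ⁻¹' C) = ∫⁻ x in C, q n x := fun n hn C hC => by
    rw [hQapply _ (hX n hC)]
    simp_rw [hlaw _ n hn C hC, hq]
    rw [lintegral_lintegral_swap
      ((hpmeas n).mul (hπmeas.comp measurable_snd)).aemeasurable]
    refine lintegral_congr fun θ => ?_
    rw [lintegral_mul_const _ (hp₀ θ n), mul_comm]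
  set B : (n : ℕ) → Set (Fin n → ℝ) := fun n =>
    {x | 1 ≤ n ∧ p n x θ₀ < ENNReal.ofReal ε * q n x} with hBdef
  have hB : ∀ n, MeasurableSet (B n) := fun n =>
    (MeasurableSet.const _).inter (measurableSet_lt (hp₀ θ₀ n) ((hqmeas n).const_mul _))
  have hbad : P θ₀ (⋃ n, (fun ω (i : Fin n) => ω i) ⁻¹' B n) ≤ ENNReal.ofReal ε := by
    have h := measure_iUnion_prefix_le (P := P θ₀) (Q := Q) (c := ENNReal.ofReal ε) hB ?_
    · rwa [hQuniv, mul_one] at h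
    intro n C hCB hC
    rcases C.eq_empty_or_nonempty with rfl | ⟨y, hy⟩
    · simp
    have hn : 1 ≤ n := (hCB hy).1
    rw [hlaw θ₀ n hn C hC, hQlaw n hn C hC, ← lintegral_const_mul _ (hqmeas n)]
    exact setLIntegral_mono ((hqmeas n).const_mul _) fun x hx => (hCB hx).2.le
  have hgood : {ω : ℕ → ℝ | ∀ n : ℕ, 1 ≤ n →
      ENNReal.ofReal ε * q n (fun i : Fin n => ω i) ≤ p n (fun i : Fin n => ω i) θ₀}
      = (⋃ n, (fun ω (i : Fin n) => ω i) ⁻¹' B n)ᶜ := by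
    ext ω
    simp [hBdef]
  have := hPprob θ₀
  rw [hgood, prob_compl_eq_one_sub (MeasurableSet.iUnion fun n => hX n (hB n))]
  exact tsub_le_tsub_left hbad 1
end

section
/- Let n ≥ 1 be a natural number and let σ₀ > 0, τ₀ > 0, ε ∈ (0, 1], and ȳ, μ₀ ∈ ℝ. Define p(θ) = (√n / √(2π σ₀²)) · exp(−n(ȳ − θ)²/(2σ₀²)) for θ ∈ ℝ, q = (2π(τ₀² + σ₀²/n))^{−1/2} · exp(−(ȳ − μ₀)²/(2(τ₀² + σ₀²/n))), and d = (σ₀/√n) · √( log((τ₀² + σ₀²/n)/(σ₀²/n)) + (ȳ − μ₀)²/(τ₀² + σ₀²/n) − 2 log ε ). Then the quantity under the square root in d is nonnegative and {θ ∈ ℝ : p(θ) ≥ ε q} = [ȳ − d, ȳ + d]. -/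
open Real

/-- The logarithm of the centred normal density with variance `v`. -/
lemma log_centered_gaussian_density {v : ℝ} (hv : 0 < v) (a : ℝ) :
    Real.log (1 / Real.sqrt (2 * π * v) * Real.exp (-a ^ 2 / (2 * v))) =
      -(Real.log (2 * π) + Real.log v + a ^ 2 / v) / 2 := by
  have hpi := Real.pi_pos
  rw [Real.log_mul (by positivity) (Real.exp_pos _).ne', Real.log_exp, one_div, Real.log_inv,
    Real.log_sqrt (by positivity), Real.log_mul (by positivity) hv.ne']
  field_simp
  ring

/-- Comparing two centred normal densities amounts to a bound on one of the squared deviations. -/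
lemma mul_gaussian_density_le_iff {v w ε : ℝ} (hv : 0 < v) (hw : 0 < w) (hε : 0 < ε) (a b : ℝ) :
    ε * (1 / Real.sqrt (2 * π * w) * Real.exp (-b ^ 2 / (2 * w))) ≤
        1 / Real.sqrt (2 * π * v) * Real.exp (-a ^ 2 / (2 * v)) ↔
      a ^ 2 ≤ v * (Real.log (w / v) + b ^ 2 / w - 2 * Real.log ε) := by
  have hpi := Real.pi_pos
  rw [← Real.log_le_log_iff (by positivity) (by positivity), Real.log_mul hε.ne' (by positivity),
    log_centered_gaussian_density hw, log_centered_gaussian_density hv,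
    Real.log_div hw.ne' hv.ne', ← div_le_iff₀' hv]
  constructor <;> intro h <;> linarith

/-- **Example 1: Robbins' confidence interval for a normal mean with known variance.**
With `p θ` the `N(θ, σ₀²/n)` density at the sample mean `ȳ`, and `q` the `N(μ₀, τ₀² + σ₀²/n)`
mixture density at `ȳ`, the region `{θ : p θ ≥ ε q}` is exactly the interval `[ȳ - d, ȳ + d]`
with `d = (σ₀/√n) √(log((τ₀² + σ₀²/n)/(σ₀²/n)) + (ȳ - μ₀)²/(τ₀² + σ₀²/n) - 2 log ε)`, the
quantity under the square root being nonnegative. -/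
theorem robbins_interval_normal_mean
    (n : ℕ) (hn : 1 ≤ n) (σ₀ τ₀ ε ybar μ₀ : ℝ)
    (hσ₀ : 0 < σ₀) (hτ₀ : 0 < τ₀) (hε : 0 < ε) (hε1 : ε ≤ 1)
    (p : ℝ → ℝ)
    (hp : ∀ θ : ℝ, p θ =
      Real.sqrt n / Real.sqrt (2 * π * σ₀ ^ 2) * Real.exp (-(n * (ybar - θ) ^ 2) / (2 * σ₀ ^ 2)))
    (q : ℝ)
    (hq : q = 1 / Real.sqrt (2 * π * (τ₀ ^ 2 + σ₀ ^ 2 / n)) *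
      Real.exp (-(ybar - μ₀) ^ 2 / (2 * (τ₀ ^ 2 + σ₀ ^ 2 / n))))
    (d : ℝ)
    (hd : d = σ₀ / Real.sqrt n *
      Real.sqrt (Real.log ((τ₀ ^ 2 + σ₀ ^ 2 / n) / (σ₀ ^ 2 / n))
        + (ybar - μ₀) ^ 2 / (τ₀ ^ 2 + σ₀ ^ 2 / n) - 2 * Real.log ε)) :
    0 ≤ Real.log ((τ₀ ^ 2 + σ₀ ^ 2 / n) / (σ₀ ^ 2 / n))
        + (ybar - μ₀) ^ 2 / (τ₀ ^ 2 + σ₀ ^ 2 / n) - 2 * Real.log ε ∧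
      {θ : ℝ | ε * q ≤ p θ} = Set.Icc (ybar - d) (ybar + d) := by
  have hn0 : (0 : ℝ) < n := by exact_mod_cast hn
  have hv : 0 < σ₀ ^ 2 / n := by positivity
  have hw : 0 < τ₀ ^ 2 + σ₀ ^ 2 / n := by positivity
  have hnonneg : 0 ≤ Real.log ((τ₀ ^ 2 + σ₀ ^ 2 / n) / (σ₀ ^ 2 / n))
      + (ybar - μ₀) ^ 2 / (τ₀ ^ 2 + σ₀ ^ 2 / n) - 2 * Real.log ε := by
    have hlog : 0 ≤ Real.log ((τ₀ ^ 2 + σ₀ ^ 2 / n) / (σ₀ ^ 2 / n)) :=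
      Real.log_nonneg ((one_le_div hv).2 (le_add_of_nonneg_left (sq_nonneg τ₀)))
    have hquad : 0 ≤ (ybar - μ₀) ^ 2 / (τ₀ ^ 2 + σ₀ ^ 2 / n) := by positivity
    linarith [Real.log_nonpos hε.le hε1]
  refine ⟨hnonneg, ?_⟩
  have hd0 : 0 ≤ d := by rw [hd]; positivity
  have hd2 : d ^ 2 = σ₀ ^ 2 / n * (Real.log ((τ₀ ^ 2 + σ₀ ^ 2 / n) / (σ₀ ^ 2 / n))
      + (ybar - μ₀) ^ 2 / (τ₀ ^ 2 + σ₀ ^ 2 / n) - 2 * Real.log ε) := by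
    rw [hd, mul_pow, div_pow, Real.sq_sqrt hn0.le, Real.sq_sqrt hnonneg]
  ext θ
  have hpθ : p θ = 1 / Real.sqrt (2 * π * (σ₀ ^ 2 / n)) *
      Real.exp (-(ybar - θ) ^ 2 / (2 * (σ₀ ^ 2 / n))) := by
    rw [hp, ← mul_div_assoc (2 * π), Real.sqrt_div (by positivity), one_div_div]
    congr 2
    field_simp
  rw [Set.mem_ofPred_eq, hpθ, hq, mul_gaussian_density_le_iff hv hw hε, ← hd2,
    sq_le_sq, abs_of_nonneg hd0, abs_le, Set.mem_Icc]
  constructor <;> rintro ⟨h₁, h₂⟩ <;> constructor <;> linarith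
end

section
/- Let μ ∈ ℝ, σ > 0, and let P be the infinite product on ℝ^ℕ of copies of the Gaussian measure N(μ, σ²). Let n ≥ 1, m ≥ 1 be natural numbers and z > 0 a real number. Write Ȳₙ(ω) = (1/n) Σ_{i<n} ωᵢ, and let Φ denote the cumulative distribution function of the standard Gaussian measure N(0, 1). Then P({ω : [Ȳₙ(ω) − σz/√n, Ȳₙ(ω) + σz/√n] ∩ [Ȳ_{n+m}(ω) − σz/√(n+m), Ȳ_{n+m}(ω) + σz/√(n+m)] = ∅}) = 2 Φ(−z(√(1 + n/m) + √(n/m))). -/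
open MeasureTheory ProbabilityTheory

/-- A finite sum of independent real Gaussian variables is Gaussian. -/
lemma hasLaw_finsetSum_gaussianReal {Ω ι : Type*} {mΩ : MeasurableSpace Ω} {P : Measure Ω}
    [IsProbabilityMeasure P] {X : ι → Ω → ℝ} {a : ι → ℝ} {v : ι → NNReal}
    (h_indep : iIndepFun X P) (hX : ∀ i, HasLaw (X i) (gaussianReal (a i) (v i)) P)
    (s : Finset ι) :
    HasLaw (∑ i ∈ s, X i) (gaussianReal (∑ i ∈ s, a i) (∑ i ∈ s, v i)) P := by
  classical
  induction s using Finset.induction_on with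
  | empty =>
    simp only [Finset.sum_empty, gaussianReal_zero_var]
    refine ⟨aemeasurable_const, ?_⟩
    change P.map (fun _ ↦ (0 : ℝ)) = Measure.dirac 0
    rw [Measure.map_const, measure_univ, one_smul]
  | insert i s hi ih =>
    rw [Finset.sum_insert hi, Finset.sum_insert hi, Finset.sum_insert hi]
    exact ⟨(hX i).aemeasurable.add ih.aemeasurable, gaussianReal_add_gaussianReal_of_indepFun
      (h_indep.indepFun_finsetSum_of_notMem₀ (fun j ↦ (hX j).aemeasurable) hi).symm
      (hX i).map_eq ih.map_eq⟩

/-- A linear combination of independent and identically distributed real Gaussian variables is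
Gaussian. -/
lemma hasLaw_finsetSum_const_mul_gaussianReal {Ω ι : Type*} {mΩ : MeasurableSpace Ω}
    {P : Measure Ω} [IsProbabilityMeasure P] {X : ι → Ω → ℝ} {a : ℝ} {v : NNReal}
    (h_indep : iIndepFun X P) (hX : ∀ i, HasLaw (X i) (gaussianReal a v) P)
    (s : Finset ι) (c : ι → ℝ) :
    HasLaw (fun ω ↦ ∑ i ∈ s, c i * X i ω)
      (gaussianReal ((∑ i ∈ s, c i) * a) ((∑ i ∈ s, c i ^ 2) * (v : ℝ)).toNNReal) P := by
  have h := hasLaw_finsetSum_gaussianReal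
    (h_indep.comp (fun i x ↦ c i * x) fun i ↦ by fun_prop)
    (fun i ↦ gaussianReal_const_mul (hX i) (c i)) s
  convert! h using 2 with ω
  · simp
  · rw [Finset.sum_mul]
  · rw [← NNReal.coe_inj, Real.coe_toNNReal _ (by positivity)]
    simp [Finset.sum_mul]

/-- The two-sided tail probability of the standard Gaussian measure. -/
lemma gaussianReal_setOf_lt_abs {t : ℝ} (ht : 0 ≤ t) :
    gaussianReal 0 1 {x | t < |x|} = ENNReal.ofReal (2 * cdf (gaussianReal 0 1) (-t)) := by
  have h_union : {x : ℝ | t < |x|} = Set.Iio (-t) ∪ Set.Ioi t := by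
    ext x
    simp only [Set.mem_ofPred_eq, Set.mem_union, Set.mem_Iio, Set.mem_Ioi, lt_abs]
    constructor <;> rintro (h | h) <;> [right; left; right; left] <;> linarith
  have h_disj : Disjoint (Set.Iio (-t)) (Set.Ioi t) := by
    rw [Set.disjoint_left]
    intro x hx hx'
    simp only [Set.mem_Iio, Set.mem_Ioi] at hx hx'
    linarith
  have h_symm : gaussianReal 0 1 (Set.Ioi t) = gaussianReal 0 1 (Set.Iio (-t)) := by
    have h := gaussianReal_map_neg (μ := 0) (v := 1)
    rw [neg_zero] at h
    conv_rhs => rw [← h]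
    rw [Measure.map_apply (by fun_prop) measurableSet_Iio]
    congr 1
    ext x
    simp
  have := nullSingletonClass_gaussianReal (μ := 0) (v := 1) one_ne_zero
  rw [h_union, measure_union h_disj measurableSet_Ioi, h_symm, measure_congr Iio_ae_eq_Iic,
    ENNReal.ofReal_mul zero_le_two, ofReal_cdf, ENNReal.ofReal_ofNat, two_mul]

/-- Two closed intervals, given by centres and nonnegative radii, are disjoint if and only if the
distance between the centres exceeds the sum of the radii. -/
lemma Icc_sub_add_inter_Icc_sub_add_eq_empty_iff {x y a b : ℝ} (ha : 0 ≤ a) (hb : 0 ≤ b) :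
    Set.Icc (x - a) (x + a) ∩ Set.Icc (y - b) (y + b) = ∅ ↔ a + b < |x - y| := by
  rw [Set.Icc_inter_Icc, Set.Icc_eq_empty_iff, lt_abs, ← not_iff_not]
  simp only [not_not, sup_le_iff, le_inf_iff, not_or, not_lt]
  constructor
  · rintro ⟨⟨_, _⟩, _, _⟩
    constructor <;> linarith
  · rintro ⟨_, _⟩
    refine ⟨⟨?_, ?_⟩, ?_, ?_⟩ <;> linarith

/-- The standardized difference of two nested sample means of i.i.d. Gaussian variables is standard
Gaussian. -/
lemma hasLaw_standardized_sub_sampleMean {Ω : Type*} {mΩ : MeasurableSpace Ω} {P : Measure Ω}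
    [IsProbabilityMeasure P] {X : ℕ → Ω → ℝ} {a : ℝ} {σ : NNReal} (hσ : 0 < σ)
    (h_indep : iIndepFun X P) (hX : ∀ i, HasLaw (X i) (gaussianReal a (σ ^ 2)) P)
    {n m : ℕ} (hn : 0 < n) (hm : 0 < m) :
    HasLaw (fun ω ↦ √n * √(n + m) / (√m * σ) *
        (1 / (n : ℝ) * ∑ i ∈ Finset.range n, X i ω
          - 1 / ((n + m : ℕ) : ℝ) * ∑ i ∈ Finset.range (n + m), X i ω))
      (gaussianReal 0 1) P := by
  have hn' : (0 : ℝ) < n := by exact_mod_cast hn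
  have hm' : (0 : ℝ) < m := by exact_mod_cast hm
  have hσ' : (0 : ℝ) < σ := by exact_mod_cast hσ
  set k : ℝ := √n * √(n + m) / (√m * σ) with hk
  have hk_sq : k ^ 2 = n * (n + m) / (m * (σ : ℝ) ^ 2) := by
    rw [hk, div_pow, mul_pow, mul_pow, Real.sq_sqrt hn'.le, Real.sq_sqrt hm'.le,
      Real.sq_sqrt (by positivity)]
  have h := hasLaw_finsetSum_const_mul_gaussianReal h_indep hX (Finset.range (n + m))
    (fun i ↦ k * ((if i < n then 1 / (n : ℝ) else 0) - 1 / ((n : ℝ) + m)))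
  have h_split (f : ℝ → ℕ → ℝ) :
      ∑ i ∈ Finset.range (n + m), f (if i < n then 1 / (n : ℝ) else 0) i
        = ∑ i ∈ Finset.range n, f (1 / n) i + ∑ i ∈ Finset.range m, f 0 (n + i) := by
    rw [Finset.sum_range_add]
    congr 1
    · refine Finset.sum_congr rfl fun i hi ↦ ?_
      rw [if_pos (Finset.mem_range.1 hi)]
    · simp
  convert! h using 2 with ω
  · rw [h_split fun x i ↦ k * (x - 1 / ((n : ℝ) + m)) * X i ω, Finset.sum_range_add,
      ← Finset.mul_sum, ← Finset.mul_sum]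
    push_cast
    ring
  · rw [h_split fun x _ ↦ k * (x - 1 / ((n : ℝ) + m))]
    simp only [Finset.sum_const, Finset.card_range, nsmul_eq_mul]
    field_simp
    ring
  · rw [h_split fun x _ ↦ (k * (x - 1 / ((n : ℝ) + m))) ^ 2]
    simp only [Finset.sum_const, Finset.card_range, nsmul_eq_mul, mul_pow, hk_sq]
    rw [eq_comm, Real.toNNReal_eq_one]
    push_cast
    field_simp
    ring

/-- **Probability that fixed-level confidence intervals at two sample sizes are disjoint.**
For i.i.d. `N(μ, σ²)` sampling (with `P` the infinite product measure on `ℝ^ℕ`, i.e. the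
projective limit of the finite products), the probability that the interval `Ȳ_n ± σz/√n` and the
interval `Ȳ_{n+m} ± σz/√(n+m)` do not overlap equals `2 Φ(-z(√(1 + n/m) + √(n/m)))`, where `Φ` is
the standard Gaussian cumulative distribution function. -/
theorem prob_disjoint_confidence_intervals
    (μ : ℝ) (σ : NNReal) (hσ : 0 < σ)
    (P : Measure (ℕ → ℝ)) [IsProbabilityMeasure P]
    (hP : IsProjectiveLimit P
      (fun J : Finset ℕ => Measure.pi fun _ : J => gaussianReal μ (σ ^ 2)))
    (n m : ℕ) (hn : 1 ≤ n) (hm : 1 ≤ m) (z : ℝ) (hz : 0 < z)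
    (Ybar : (k : ℕ) → (ℕ → ℝ) → ℝ)
    (hYbar : ∀ k : ℕ, ∀ ω, Ybar k ω = (1 / (k : ℝ)) * ∑ i ∈ Finset.range k, ω i) :
    P {ω | Set.Icc (Ybar n ω - σ * z / Real.sqrt n) (Ybar n ω + σ * z / Real.sqrt n)
          ∩ Set.Icc (Ybar (n + m) ω - σ * z / Real.sqrt (n + m))
              (Ybar (n + m) ω + σ * z / Real.sqrt (n + m)) = (∅ : Set ℝ)}
      = ENNReal.ofReal
          (2 * cdf (gaussianReal 0 1)
            (-(z * (Real.sqrt (1 + (n : ℝ) / m) + Real.sqrt ((n : ℝ) / m))))) := by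
  have hn' : (0 : ℝ) < n := by exact_mod_cast hn
  have hm' : (0 : ℝ) < m := by exact_mod_cast hm
  have hσ' : (0 : ℝ) < σ := by exact_mod_cast hσ
  have hP_eq : P = Measure.infinitePi fun _ : ℕ ↦ gaussianReal μ (σ ^ 2) :=
    hP.unique (Measure.isProjectiveLimit_infinitePi _)
  have h_indep : iIndepFun (fun (i : ℕ) (ω : ℕ → ℝ) ↦ ω i) P := by
    rw [hP_eq]
    exact iIndepFun_infinitePi (X := fun _ x ↦ x) fun _ ↦ measurable_id
  have h_law (i : ℕ) : HasLaw (fun ω : ℕ → ℝ ↦ ω i) (gaussianReal μ (σ ^ 2)) P :=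
    ⟨(measurable_pi_apply i).aemeasurable, by rw [hP_eq]; exact Measure.infinitePi_map_eval _ i⟩
  have h := hasLaw_standardized_sub_sampleMean hσ h_indep h_law hn hm
  set t : ℝ := z * (√(1 + (n : ℝ) / m) + √((n : ℝ) / m)) with ht
  have h_meas : MeasurableSet {x : ℝ | t < |x|} := measurableSet_lt (by fun_prop) (by fun_prop)
  rw [← gaussianReal_setOf_lt_abs (by positivity), ← h.measure_eq h_meas]
  congr 1
  ext ω
  simp only [Set.mem_ofPred_eq]
  rw [Icc_sub_add_inter_Icc_sub_add_eq_empty_iff (by positivity) (by positivity),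
    hYbar, hYbar, abs_mul, abs_of_pos (by positivity : 0 < √n * √(n + m) / (√m * σ))]
  have h_t : t = √n * √(n + m) / (√m * σ) * (σ * z / √n + σ * z / √(n + m)) := by
    have h_add : 1 + (n : ℝ) / m = (n + m) / m := by field_simp; ring
    rw [ht, h_add, Real.sqrt_div (by positivity), Real.sqrt_div hn'.le]
    have h₁ : 0 < √(n : ℝ) := by positivity
    have h₂ : 0 < √(m : ℝ) := by positivity
    have h₃ : 0 < √((n : ℝ) + m) := by positivity
    field_simp
  rw [h_t, mul_lt_mul_iff_right₀ (by positivity)]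
end
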